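/- arXiv:1311.5175 — 2 statements merged into one kernel-verified Lean document; each statement's English description precedes it below -/
import Mathlib

section
/- Let D ⊂ ℂⁿ be a bounded domain of class C¹ with defining function ρ on a neighborhood U of bD. (i) If D is strictly ℂ-linearly convex, then for every z ∈ D there is an open set U_z ⊆ ℂⁿ∖{z} with bD ⊂ U_z ⊆ U such that ⟨∂ρ(w), w − z⟩ ≠ 0 for every w ∈ U_z. (ii) If moreover D is strongly ℂ-linearly convex with constant C > 0, then for every z ∈ D there are an open set U_z ⊆ ℂⁿ∖{z} with bD ⊂ U_z ⊆ U and a constant C′ > 0 such that |⟨∂ρ(w), w − z⟩| ≥ C′|w − z|² for every w ∈ U_z. -/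
open MeasureTheory Complex

noncomputable section

/-- ℂⁿ with the Euclidean norm. -/
abbrev Cn (n : ℕ) := EuclideanSpace ℂ (Fin n)

instance (n : ℕ) : MeasurableSpace (Cn n) := borel _
instance (n : ℕ) : BorelSpace (Cn n) := ⟨rfl⟩

/-- Wirtinger derivative ∂f/∂ζⱼ of `f : ℂⁿ → ℂ` at `w`. -/
def wderiv {n : ℕ} (f : Cn n → ℂ) (w : Cn n) (j : Fin n) : ℂ :=
  (1/2) * (fderiv ℝ f w (EuclideanSpace.single j (1:ℂ))
            - Complex.I * fderiv ℝ f w (EuclideanSpace.single j Complex.I))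

/-- Conjugate Wirtinger derivative ∂f/∂ζ̄ⱼ of `f : ℂⁿ → ℂ` at `w`. -/
def wderivBar {n : ℕ} (f : Cn n → ℂ) (w : Cn n) (j : Fin n) : ℂ :=
  (1/2) * (fderiv ℝ f w (EuclideanSpace.single j (1:ℂ))
            + Complex.I * fderiv ℝ f w (EuclideanSpace.single j Complex.I))

/-- A real-valued function regarded as complex valued. -/
def realToC {n : ℕ} (ρ : Cn n → ℝ) : Cn n → ℂ := fun w => (ρ w : ℂ)

/-- ⟨∂ρ(w), ξ⟩ = Σⱼ (∂ρ/∂ζⱼ)(w) ξⱼ. -/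
def delPair {n : ℕ} (ρ : Cn n → ℝ) (w ξ : Cn n) : ℂ :=
  ∑ j, wderiv (realToC ρ) w j * ξ j

/-- Second Wirtinger derivative ∂²ρ/∂ζⱼ∂ζₖ. -/
def wderiv2 {n : ℕ} (ρ : Cn n → ℝ) (w : Cn n) (j k : Fin n) : ℂ :=
  wderiv (fun v => wderiv (realToC ρ) v j) w k

/-- The Levi form L_w(ρ)(ξ) = Σ_{j,k} (∂²ρ/∂ζⱼ∂ζ̄ₖ)(w) ξⱼ ξ̄ₖ (a real number). -/
def leviForm {n : ℕ} (ρ : Cn n → ℝ) (w ξ : Cn n) : ℝ :=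
  (∑ j, ∑ k, wderivBar (fun v => wderiv (realToC ρ) v j) w k * ξ j * (starRingEnd ℂ) (ξ k)).re

/-- Surface measure σ on bD: (2n−1)-dimensional Hausdorff measure restricted to the boundary. -/
def bSigma {n : ℕ} (D : Set (Cn n)) : Measure (Cn n) :=
  (μH[(2*(n:ℝ) - 1)]).restrict (frontier D)

/-- Lebesgue measure dV on ℂⁿ ≅ ℝ²ⁿ, realized as 2n-dimensional Hausdorff measure. -/
def dVol (n : ℕ) : Measure (Cn n) := μH[(2*(n:ℝ))]

theorem continuousOn_delPair_aux {n : ℕ} (U : Set (Cn n)) (ρ : Cn n → ℝ) (hUo : IsOpen U)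
    (hρ : ContDiffOn ℝ 1 ρ U) (z : Cn n) :
    ContinuousOn (fun w => delPair ρ w (w - z)) U := by
  have h1 : ContDiffOn ℝ 1 (realToC ρ) U :=
    (Complex.ofRealCLM.contDiff (n := 1)).comp_contDiffOn hρ
  have h2 : ContinuousOn (fderiv ℝ (realToC ρ)) U :=
    h1.continuousOn_fderiv_of_isOpen hUo le_rfl
  have h3 : ∀ v : Cn n, ContinuousOn (fun w => fderiv ℝ (realToC ρ) w v) U :=
    fun v => h2.clm_apply continuousOn_const
  unfold delPair wderiv
  refine continuousOn_finsetSum _ fun j _ => ContinuousOn.mul ?_ ?_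
  · exact continuousOn_const.mul ((h3 _).sub (continuousOn_const.mul (h3 _)))
  · exact Continuous.continuousOn (by fun_prop)

theorem delPair_zero_aux {n : ℕ} (ρ : Cn n → ℝ) (z : Cn n) : delPair ρ z (z - z) = 0 := by
  simp [delPair]

/-- For a bounded `C¹` domain: (i) strict ℂ-linear convexity gives,
for each `z ∈ D`, a neighborhood `U_z` of `bD` avoiding `z` on which
`⟨∂ρ(w), w−z⟩ ≠ 0`; (ii) strong ℂ-linear convexity gives such a neighborhood on which
the quadratic lower bound persists. -/
theorem strictly_C_linearly_convex_nbhd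
    {n : ℕ} (hn : 1 ≤ n) (D U : Set (Cn n)) (ρ : Cn n → ℝ)
    (hDo : IsOpen D) (hDconn : IsConnected D) (hDb : Bornology.IsBounded D)
    (hUo : IsOpen U) (hUb : frontier D ⊆ U)
    (hρ : ContDiffOn ℝ 1 ρ U)
    (hdef : U ∩ D = {w ∈ U | ρ w < 0})
    (hgrad : ∀ w ∈ U, fderiv ℝ ρ w ≠ 0) :
    ((∀ w ∈ frontier D, ∀ z ∈ closure D, z ≠ w → delPair ρ w (w - z) ≠ 0) →
      ∀ z ∈ D, ∃ Uz : Set (Cn n), IsOpen Uz ∧ frontier D ⊆ Uz ∧ Uz ⊆ U ∧ z ∉ Uz ∧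
        ∀ w ∈ Uz, delPair ρ w (w - z) ≠ 0) ∧
    (∀ C : ℝ, 0 < C →
      (∀ w ∈ frontier D, ∀ z ∈ closure D,
        C * ‖w - z‖ ^ 2 ≤ ‖delPair ρ w (w - z)‖) →
      ∀ z ∈ D, ∃ (Uz : Set (Cn n)) (C' : ℝ), 0 < C' ∧
        IsOpen Uz ∧ frontier D ⊆ Uz ∧ Uz ⊆ U ∧ z ∉ Uz ∧
        ∀ w ∈ Uz, C' * ‖w - z‖ ^ 2 ≤ ‖delPair ρ w (w - z)‖) := by
  refine ⟨fun h z hz => ?_, fun C hC h z hz => ?_⟩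
  · have hc := continuousOn_delPair_aux U ρ hUo hρ z
    refine ⟨U ∩ (fun w => delPair ρ w (w - z)) ⁻¹' {0}ᶜ,
      hc.isOpen_inter_preimage hUo isOpen_compl_singleton, ?_, Set.inter_subset_left, ?_, ?_⟩
    · intro w hw
      refine ⟨hUb hw, h w hw z (subset_closure hz) ?_⟩
      rintro rfl
      rw [hDo.frontier_eq] at hw
      exact hw.2 hz
    · intro hzz
      exact hzz.2 (delPair_zero_aux ρ z)
    · intro w hw
      exact hw.2
  · have hc := continuousOn_delPair_aux U ρ hUo hρ z
    have hc2 : ContinuousOn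
        (fun w => ‖delPair ρ w (w - z)‖ - C / 2 * ‖w - z‖ ^ 2) U :=
      hc.norm.sub (Continuous.continuousOn (by fun_prop))
    refine ⟨U ∩ (fun w => ‖delPair ρ w (w - z)‖ - C / 2 * ‖w - z‖ ^ 2) ⁻¹' Set.Ioi 0, C / 2,
      by positivity, hc2.isOpen_inter_preimage hUo isOpen_Ioi, ?_, Set.inter_subset_left, ?_, ?_⟩
    · intro w hw
      refine ⟨hUb hw, ?_⟩
      have hne : w ≠ z := by
        rintro rfl
        rw [hDo.frontier_eq] at hw
        exact hw.2 hz
      have hpos : 0 < ‖w - z‖ := norm_pos_iff.mpr (sub_ne_zero.mpr hne)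
      have h1 := h w hw z (subset_closure hz)
      have h2 : 0 < C * ‖w - z‖ ^ 2 := by positivity
      simp only [Set.mem_preimage, Set.mem_Ioi]
      linarith
    · intro hzz
      have h1 := hzz.2
      simp [delPair] at h1
    · intro w hw
      have h1 := hw.2
      simp only [Set.mem_preimage, Set.mem_Ioi] at h1
      linarith

end
end

section
/- Every strongly ℂ-linearly convex bounded domain of class C² is strongly pseudoconvex: if D ⊂ ℂⁿ is a bounded domain of class C² with defining function ρ and there is C > 0 with |⟨∂ρ(w), w − z⟩| ≥ C|w − z|² for all w ∈ bD and all z ∈ D̄, then for every w ∈ bD and every nonzero ξ ∈ ℂⁿ with ⟨∂ρ(w), ξ⟩ = 0 one has L_w(ρ)(ξ) > 0. -/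
open MeasureTheory Complex

noncomputable section

lemma aux_decomp {n : ℕ} (ξ : Cn n) :
    ξ = ∑ j, ((ξ j).re • EuclideanSpace.single j (1:ℂ)
      + (ξ j).im • EuclideanSpace.single j Complex.I : Cn n) := by
  ext i
  simp [Finset.sum_apply, Finset.sum_add_distrib, Pi.single_apply, Complex.re_add_im]

lemma aux_lin {n : ℕ} {F : Type*} [NormedAddCommGroup F] [NormedSpace ℝ F]
    (L : Cn n →L[ℝ] F) (ξ : Cn n) :
    L ξ = ∑ j, ((ξ j).re • L (EuclideanSpace.single j (1:ℂ))
      + (ξ j).im • L (EuclideanSpace.single j Complex.I)) := by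
  conv_lhs => rw [aux_decomp ξ]
  simp only [map_sum, map_add, map_smul]

lemma aux_wderiv {n : ℕ} {ρ : Cn n → ℝ} {v : Cn n} (h : DifferentiableAt ℝ ρ v) (j : Fin n) :
    wderiv (realToC ρ) v j = (1/2) * ((fderiv ℝ ρ v (EuclideanSpace.single j (1:ℂ)) : ℂ)
      - Complex.I * (fderiv ℝ ρ v (EuclideanSpace.single j Complex.I) : ℂ)) := by
  have h1 : HasFDerivAt (realToC ρ) (Complex.ofRealCLM.comp (fderiv ℝ ρ v)) v :=
    Complex.ofRealCLM.hasFDerivAt.comp v h.hasFDerivAt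
  unfold wderiv
  rw [h1.fderiv]
  simp

lemma aux_delPair_re {n : ℕ} {ρ : Cn n → ℝ} {v : Cn n} (h : DifferentiableAt ℝ ρ v) (ξ : Cn n) :
    (delPair ρ v ξ).re = (1/2) * fderiv ℝ ρ v ξ := by
  unfold delPair
  rw [aux_lin (fderiv ℝ ρ v) ξ, Complex.re_sum, Finset.mul_sum]
  refine Finset.sum_congr rfl fun j _ => ?_
  rw [aux_wderiv h]
  simp
  ring

lemma aux_delPair_smul {n : ℕ} (ρ : Cn n → ℝ) (v ξ : Cn n) (c : ℂ) :
    delPair ρ v (c • ξ) = c * delPair ρ v ξ := by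
  unfold delPair
  rw [Finset.mul_sum]
  refine Finset.sum_congr rfl fun j _ => ?_
  simp
  ring

lemma aux_delPair_add {n : ℕ} (ρ : Cn n → ℝ) (v ξ η : Cn n) :
    delPair ρ v (ξ + η) = delPair ρ v ξ + delPair ρ v η := by
  unfold delPair
  rw [← Finset.sum_add_distrib]
  refine Finset.sum_congr rfl fun j _ => ?_
  simp
  ring

lemma aux_bilin {n : ℕ} (A : Cn n →L[ℝ] Cn n →L[ℝ] ℝ) (ξ : Cn n) :
    A ξ ξ = ∑ j, ∑ k, 
      ((ξ k).re * (ξ j).re * A (EuclideanSpace.single k 1) (EuclideanSpace.single j 1)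
      + (ξ k).re * (ξ j).im * A (EuclideanSpace.single k 1) (EuclideanSpace.single j Complex.I)
      + (ξ k).im * (ξ j).re * A (EuclideanSpace.single k Complex.I) (EuclideanSpace.single j 1)
      + (ξ k).im * (ξ j).im *
        A (EuclideanSpace.single k Complex.I) (EuclideanSpace.single j Complex.I)) := by
  rw [aux_lin (A ξ) ξ]
  refine Finset.sum_congr rfl fun j _ => ?_
  rw [aux_lin A ξ]
  simp only [ContinuousLinearMap.sum_apply, ContinuousLinearMap.add_apply,
    ContinuousLinearMap.smul_apply, smul_eq_mul, Finset.mul_sum]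
  rw [← Finset.sum_add_distrib]
  refine Finset.sum_congr rfl fun k _ => ?_
  ring

lemma aux_levi {n : ℕ} {ρ : Cn n → ℝ} {w : Cn n} {A : Cn n →L[ℝ] Cn n →L[ℝ] ℝ}
    (hd : ∀ᶠ v in nhds w, DifferentiableAt ℝ ρ v)
    (hA : HasFDerivAt (fderiv ℝ ρ) A w) (ξ : Cn n) :
    leviForm ρ w ξ = (1/4) * (A ξ ξ + A (Complex.I • ξ) (Complex.I • ξ)) := by
  have key : ∀ (j : Fin n) (u : Cn n), fderiv ℝ (fun v => wderiv (realToC ρ) v j) w u =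
      (1/2) * ((A u (EuclideanSpace.single j (1:ℂ)) : ℂ)
        - Complex.I * (A u (EuclideanSpace.single j Complex.I) : ℂ)) := by
    intro j u
    have hev : (fun v => wderiv (realToC ρ) v j) =ᶠ[nhds w] fun v =>
        (1/2 : ℂ) * ((fderiv ℝ ρ v (EuclideanSpace.single j (1:ℂ)) : ℂ)
      - Complex.I * (fderiv ℝ ρ v (EuclideanSpace.single j Complex.I) : ℂ)) := by
      filter_upwards [hd] with v hv using aux_wderiv hv j
    rw [hev.fderiv_eq]
    have h0 : ∀ e : Cn n, HasFDerivAt (fun v => ((fderiv ℝ ρ v e : ℝ) : ℂ))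
        (Complex.ofRealCLM.comp (A.flip e)) w := by
      intro e
      have h1 : HasFDerivAt (fun v => fderiv ℝ ρ v e) (A.flip e) w := by
        have := hA.clm_apply (hasFDerivAt_const e w)
        have e0 : fderiv ℝ ρ w ∘SL (0 : Cn n →L[ℝ] Cn n) + A.flip e = A.flip e := by
          ext x
          simp
        rwa [e0] at this
      exact Complex.ofRealCLM.hasFDerivAt.comp w h1
    have h2 := ((h0 (EuclideanSpace.single j (1:ℂ))).sub
      ((h0 (EuclideanSpace.single j Complex.I)).const_mul Complex.I)).const_mul (1/2 : ℂ)
    have h3 := h2.fderiv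
    simp only [Pi.sub_def] at h3
    rw [h3]
    simp
  unfold leviForm wderivBar
  rw [aux_bilin A ξ, aux_bilin A (Complex.I • ξ), ← Finset.sum_add_distrib, Complex.re_sum,
    Finset.mul_sum]
  refine Finset.sum_congr rfl fun j _ => ?_
  rw [← Finset.sum_add_distrib, Complex.re_sum, Finset.mul_sum]
  refine Finset.sum_congr rfl fun k _ => ?_
  rw [key, key]
  simp
  ring

lemma aux_second {ρ' : ℝ → ℝ} {g' : ℝ → ℝ} {c : ℝ}
    (h1 : ∀ᶠ t in nhds 0, HasDerivAt ρ' (g' t) t) (h2 : HasDerivAt g' c 0)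
    (h0 : ρ' 0 = 0) (h0' : g' 0 = 0) (hnn : ∀ᶠ t in nhds 0, 0 ≤ ρ' t) : 0 ≤ c := by
  by_contra hc
  push Not at hc
  have e1 : deriv ρ' =ᶠ[nhds 0] g' := by
    filter_upwards [h1] with t ht using ht.deriv
  have e2 : deriv (deriv ρ') 0 = c := by rw [e1.deriv_eq, h2.deriv]
  have hm : IsLocalMax ρ' 0 :=
    isLocalMax_of_deriv_deriv_neg (by rw [e2]; exact hc) (by rw [e1.eq_of_nhds, h0'])
      h1.self_of_nhds.continuousAt
  have e3 : ρ' =ᶠ[nhds 0] fun _ => (0:ℝ) := by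
    filter_upwards [hm, hnn] with t ht ht'
    rw [h0] at ht
    exact le_antisymm ht ht'
  have e4 := e3.deriv.deriv_eq
  rw [e2] at e4
  simp at e4
  exact hc.ne e4

lemma aux_key {n : ℕ} {D U : Set (Cn n)} {ρ : Cn n → ℝ}
    (hUo : IsOpen U)
    (hdef : U ∩ D = {w ∈ U | ρ w < 0})
    {C : ℝ} (hC : 0 < C) {w : Cn n} (hwU : w ∈ U) (hw0 : ρ w = 0)
    (hgrad : fderiv ℝ ρ w ≠ 0)
    (hconv : ∀ z ∈ closure D, C * ‖w - z‖ ^ 2 ≤ ‖delPair ρ w (w - z)‖)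
    {A : Cn n →L[ℝ] Cn n →L[ℝ] ℝ}
    (hd : ∀ᶠ v in nhds w, DifferentiableAt ℝ ρ v)
    (hA : HasFDerivAt (fderiv ℝ ρ) A w) {ξ : Cn n} (hξ : ξ ≠ 0) (hξ0 : delPair ρ w ξ = 0) :
    0 < A ξ ξ := by
  obtain ⟨ν, hν⟩ : ∃ ν, 0 < fderiv ℝ ρ w ν := by
    by_contra hcon
    push Not at hcon
    apply hgrad
    ext v
    have a := hcon v
    have b := hcon (-v)
    simp at b
    simp
    linarith
  set K := ‖delPair ρ w ν‖ with hK
  have hK0 : 0 ≤ K := norm_nonneg _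
  have hξn : 0 < ‖ξ‖ := norm_pos_iff.mpr hξ
  obtain ⟨ε, hε, hεK⟩ : ∃ ε : ℝ, 0 < ε ∧ ε * K < C * ‖ξ‖ ^ 2 := by
    refine ⟨C * ‖ξ‖ ^ 2 / (K + 1), by positivity, ?_⟩
    rw [div_mul_eq_mul_div, div_lt_iff₀ (by positivity)]
    have : 0 < C * ‖ξ‖ ^ 2 := by positivity
    nlinarith
  have hdξ : fderiv ℝ ρ w ξ = 0 := by
    have := aux_delPair_re hd.self_of_nhds ξ
    rw [hξ0] at this
    simpa using this.symm
  let γ : ℝ → Cn n := fun t => w + (t • ξ - (ε * t ^ 2) • ν)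
  let γ' : ℝ → Cn n := fun t => ξ - (ε * (2 * t)) • ν
  have hγ : ∀ t, HasDerivAt γ (γ' t) t := by
    intro t
    have h1 : HasDerivAt (fun t : ℝ => t • ξ) ((1:ℝ) • ξ) t := (hasDerivAt_id t).smul_const ξ
    have h2 : HasDerivAt (fun t : ℝ => (ε * t ^ 2) • ν) ((ε * (2 * t)) • ν) t := by
      have := ((hasDerivAt_pow 2 t).const_mul ε).smul_const ν
      simpa using this
    have := (h1.sub h2).const_add w
    simpa [γ, γ'] using this
  have hγ' : HasDerivAt γ' (-((2 * ε) • ν)) 0 := by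
    have h2 : HasDerivAt (fun t : ℝ => (ε * (2 * t)) • ν) ((ε * (2 * 1)) • ν) 0 :=
      (((hasDerivAt_id (0:ℝ)).const_mul 2).const_mul ε).smul_const ν
    have := h2.const_sub ξ
    rwa [show ε * (2 * 1) = 2 * ε by ring] at this
  have hγ0 : γ 0 = w := by simp [γ]
  have hγ'0 : γ' 0 = ξ := by simp [γ']
  have hγc : Filter.Tendsto γ (nhds 0) (nhds w) := by
    have := (hγ 0).continuousAt
    unfold ContinuousAt at this
    rwa [hγ0] at this
  have hmain : 0 ≤ A ξ ξ + fderiv ℝ ρ w (-((2 * ε) • ν)) := by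
    refine aux_second (ρ' := fun t => ρ (γ t)) (g' := fun t => fderiv ℝ ρ (γ t) (γ' t))
      ?_ ?_ ?_ ?_ ?_
    · filter_upwards [hγc.eventually hd] with t ht
      exact ht.hasFDerivAt.comp_hasDerivAt t (hγ t)
    · have hA' : HasFDerivAt (fderiv ℝ ρ) A (γ 0) := by rwa [hγ0]
      have h1 := hA'.comp_hasDerivAt (0:ℝ) (hγ 0)
      have h2 := h1.clm_apply hγ'
      simpa [hγ0, hγ'0] using h2
    · simp [hγ0, hw0]
    · simp [hγ0, hγ'0, hdξ]
    · have hcont : Continuous fun t : ℝ => C * ‖ξ - (ε * t) • ν‖ ^ 2 := by fun_prop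
      have hev : ∀ᶠ t : ℝ in nhds 0, ε * K < C * ‖ξ - (ε * t) • ν‖ ^ 2 := by
        apply hcont.continuousAt.eventually_const_lt
        simpa using hεK
      filter_upwards [hev, hγc.eventually (hUo.mem_nhds hwU)] with t ht htU
      by_contra hneg
      push Not at hneg
      have hD : γ t ∈ D := by
        have : γ t ∈ U ∩ D := by rw [hdef]; exact ⟨htU, hneg⟩
        exact this.2
      have ht0 : t ≠ 0 := by
        rintro rfl
        rw [hγ0, hw0] at hneg
        exact lt_irrefl _ hneg
      have hc := hconv _ (subset_closure hD)
      have e1 : w - γ t = (-t) • (ξ - (ε * t) • ν) := by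
        simp only [γ]
        module
      have e2 : w - γ t = ((-t : ℝ) : ℂ) • ξ + ((ε * t ^ 2 : ℝ) : ℂ) • ν := by
        rw [Complex.coe_smul, Complex.coe_smul]
        simp only [γ]
        module
      have e3 : ‖delPair ρ w (w - γ t)‖ = ε * t ^ 2 * K := by
        rw [e2, aux_delPair_add, aux_delPair_smul, aux_delPair_smul, hξ0, mul_zero, zero_add,
          norm_mul, Complex.norm_real, Real.norm_of_nonneg (by positivity)]
      rw [e3, e1, norm_smul, mul_pow, Real.norm_eq_abs, sq_abs] at hc
      have : 0 < t ^ 2 := by positivity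
      nlinarith
  have : fderiv ℝ ρ w (-((2 * ε) • ν)) = -(2 * ε * fderiv ℝ ρ w ν) := by simp
  rw [this] at hmain
  have : 0 < 2 * ε * fderiv ℝ ρ w ν := by positivity
  linarith

/-- Every bounded strongly ℂ-linearly convex domain of class `C²` is
strongly pseudoconvex. -/
theorem strongly_C_linearly_convex_implies_strongly_pseudoconvex
    {n : ℕ} (hn : 1 ≤ n) (D U : Set (Cn n)) (ρ : Cn n → ℝ)
    (hDo : IsOpen D) (hDconn : IsConnected D) (hDb : Bornology.IsBounded D)
    (hUo : IsOpen U) (hUb : frontier D ⊆ U)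
    (hρ : ContDiffOn ℝ 2 ρ U)
    (hdef : U ∩ D = {w ∈ U | ρ w < 0})
    (hgrad : ∀ w ∈ U, fderiv ℝ ρ w ≠ 0)
    (C : ℝ) (hC : 0 < C)
    (hconv : ∀ w ∈ frontier D, ∀ z ∈ closure D,
      C * ‖w - z‖ ^ 2 ≤ ‖delPair ρ w (w - z)‖) :
    ∀ w ∈ frontier D, ∀ ξ : Cn n, ξ ≠ 0 → delPair ρ w ξ = 0 → 0 < leviForm ρ w ξ := by

  intro w hw ξ hξ hξ0
  have hwU := hUb hw
  have hcd : ContDiffAt ℝ 2 ρ w := hρ.contDiffAt (hUo.mem_nhds hwU)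
  have hd : ∀ᶠ v in nhds w, DifferentiableAt ℝ ρ v := by
    filter_upwards [hUo.mem_nhds hwU] with v hv
    exact (hρ.contDiffAt (hUo.mem_nhds hv)).differentiableAt (by norm_num)
  have hA : HasFDerivAt (fderiv ℝ ρ) (fderiv ℝ (fderiv ℝ ρ) w) w :=
    ((hcd.fderiv_right (m := 1) (by norm_num)).differentiableAt (by norm_num)).hasFDerivAt
  have hwD : w ∉ D := by
    have := hw.2
    rwa [hDo.interior_eq] at this
  have hw0 : ρ w = 0 := by
    apply le_antisymm
    · by_contra hpos
      push Not at hpos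
      have hev := hcd.continuousAt.eventually_const_lt hpos
      have hfr := mem_closure_iff_frequently.mp hw.1
      obtain ⟨v, hvD, hv, hvU⟩ := (hfr.and_eventually (hev.and (hUo.mem_nhds hwU))).exists
      have : v ∈ U ∩ D := ⟨hvU, hvD⟩
      rw [hdef] at this
      exact lt_asymm hv this.2
    · by_contra hneg
      push Not at hneg
      have : w ∈ U ∩ D := by rw [hdef]; exact ⟨hwU, hneg⟩
      exact hwD this.2
  rw [aux_levi hd hA]
  have h1 := aux_key hUo hdef hC hwU hw0 (hgrad w hwU) (hconv w hw) hd hA hξ hξ0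
  have h2 := aux_key hUo hdef hC hwU hw0 (hgrad w hwU) (hconv w hw) hd hA
    (ξ := Complex.I • ξ) (smul_ne_zero Complex.I_ne_zero hξ)
    (by rw [aux_delPair_smul, hξ0, mul_zero])
  positivity

end
end
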